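/- Let A be a separable unital C*-algebra and let K, K' ⊆ A be two compact generating sets. Then there exists a function ω ∈ Ω (continuous, nondecreasing, concave, ω(0)=0) such that d_{K'}(π,π') ≤ ω(d_K(π,π')) for all π, π' ∈ Rep(A). -/

import Mathlib

noncomputable section

abbrev H2 : Type := lp (fun _ : ℕ => ℂ) 2
abbrev BH : Type := H2 →L[ℂ] H2

abbrev RepSp (A : Type*) [CStarAlgebra A] := A →⋆ₐ[ℂ] BH

def Generates {A : Type*} [CStarAlgebra A] (K : Set A) : Prop :=
  (StarAlgebra.adjoin ℂ K).topologicalClosure = ⊤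

def dRep {A : Type*} [CStarAlgebra A] (K : Set A) (π₁ π₂ : RepSp A) : ℝ :=
  ⨆ a ∈ K, ‖π₁ a - π₂ a‖

/-- A modulus of continuity: a continuous, nondecreasing, concave function
`[0,∞) → [0,∞)` vanishing at `0`. -/
def IsModulus (ω : ℝ → ℝ) : Prop :=
  ContinuousOn ω (Set.Ici 0) ∧ MonotoneOn ω (Set.Ici 0) ∧
    ConcaveOn ℝ (Set.Ici 0) ω ∧ ω 0 = 0 ∧ ∀ t ∈ Set.Ici (0 : ℝ), 0 ≤ ω t

open Filter Topology in
/-- If `g` is dominated by `ε + C * f` for every `ε > 0` and some `C` depending on `ε`, then `g` is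
dominated by a modulus of continuity evaluated at `f`. -/
theorem exists_isModulus_of_forall_le_add_mul {ι : Type*} (f g : ι → ℝ)
    (h : ∀ ε > 0, ∃ C, 0 ≤ C ∧ ∀ i, g i ≤ ε + C * f i) :
    ∃ ω : ℝ → ℝ, IsModulus ω ∧ ∀ i, g i ≤ ω (f i) := by
  let S : Set (ℝ × ℝ) := {p | 0 ≤ p.1 ∧ 0 ≤ p.2 ∧ ∀ i, g i ≤ p.1 + p.2 * f i}
  let ω : ℝ → ℝ := fun t => ⨅ p : S, (p.1.1 + p.1.2 * t)
  have hS : Nonempty S := by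
    obtain ⟨C, hC, hg⟩ := h 1 one_pos
    exact ⟨⟨(1, C), zero_le_one, hC, hg⟩⟩
  have hbd : ∀ t, 0 ≤ t → BddBelow (Set.range fun p : S => p.1.1 + p.1.2 * t) := by
    rintro t ht
    refine ⟨0, ?_⟩
    rintro _ ⟨p, rfl⟩
    exact add_nonneg p.2.1 (mul_nonneg p.2.2.1 ht)
  have hle : ∀ t, 0 ≤ t → ∀ p : S, ω t ≤ p.1.1 + p.1.2 * t := fun t ht p => ciInf_le (hbd t ht) p
  have hnonneg : ∀ t, 0 ≤ t → 0 ≤ ω t := fun t ht =>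
    le_ciInf fun p => add_nonneg p.2.1 (mul_nonneg p.2.2.1 ht)
  have hzero : ω 0 = 0 := by
    refine le_antisymm (le_of_forall_pos_le_add fun ε hε => ?_) (hnonneg 0 le_rfl)
    obtain ⟨C, hC, hg⟩ := h ε hε
    simpa using hle 0 le_rfl ⟨(ε, C), hε.le, hC, hg⟩
  have hconc : ConcaveOn ℝ (Set.Ici 0) ω := by
    refine ⟨convex_Ici 0, fun x hx y hy a b ha hb hab => le_ciInf fun p => ?_⟩
    have h1 := mul_le_mul_of_nonneg_left (hle x hx p) ha
    have h2 := mul_le_mul_of_nonneg_left (hle y hy p) hb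
    simp only [smul_eq_mul]
    linear_combination h1 + h2 + p.1.1 * hab
  have hcont : ContinuousOn ω (Set.Ici 0) := by
    intro t ht
    rcases eq_or_lt_of_le (Set.mem_Ici.1 ht) with rfl | ht
    · rw [ContinuousWithinAt, hzero, Metric.tendsto_nhds]
      intro ε hε
      obtain ⟨C, hC, hg⟩ := h (ε / 2) (half_pos hε)
      have hlim : Tendsto (fun t : ℝ => ε / 2 + C * t) (𝓝[Set.Ici 0] 0) (𝓝 (ε / 2 + C * 0)) :=
        (Continuous.tendsto (by fun_prop) 0).mono_left nhdsWithin_le_nhds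
      filter_upwards [hlim.eventually_lt_const (u := ε) (by linarith), self_mem_nhdsWithin]
        with t hlt ht
      rw [Real.dist_0_eq_abs, abs_of_nonneg (hnonneg t ht)]
      exact (hle t ht ⟨(ε / 2, C), (half_pos hε).le, hC, hg⟩).trans_lt hlt
    · have := hconc.continuousOn_interior
      rw [interior_Ici] at this
      exact (this.continuousAt (Ioi_mem_nhds ht)).continuousWithinAt
  refine ⟨ω, ⟨hcont, fun x hx y hy hxy => le_ciInf fun p => ?_, hconc, hzero, hnonneg⟩,
    fun i => le_ciInf fun p => p.2.2.2 i⟩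
  exact (hle x hx p).trans (add_le_add_right (mul_le_mul_of_nonneg_left hxy p.2.2.1) _)

section Representations

variable {A : Type*} [CStarAlgebra A]

theorem dRep_nonneg (K : Set A) (π π' : RepSp A) : 0 ≤ dRep K π π' :=
  Real.iSup_nonneg fun _ => Real.iSup_nonneg fun _ => norm_nonneg _

theorem dRep_le {K : Set A} {π π' : RepSp A} {r : ℝ} (hr : 0 ≤ r)
    (h : ∀ a ∈ K, ‖π a - π' a‖ ≤ r) : dRep K π π' ≤ r :=
  Real.iSup_le (fun a => Real.iSup_le (h a) hr) hr

theorem norm_repSp_sub_le (π π' : RepSp A) (a : A) : ‖π a - π' a‖ ≤ 2 * ‖a‖ := by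
  have h1 := NonUnitalStarAlgHom.norm_apply_le π a
  have h2 := NonUnitalStarAlgHom.norm_apply_le π' a
  linarith [norm_sub_le (π a) (π' a)]

theorem norm_sub_le_dRep {K : Set A} (hK : IsCompact K) (π π' : RepSp A) {a : A} (ha : a ∈ K) :
    ‖π a - π' a‖ ≤ dRep K π π' := by
  obtain ⟨M, hM⟩ := hK.isBounded.exists_norm_le
  have hbd : BddAbove (Set.range fun a : A => ⨆ _ : a ∈ K, ‖π a - π' a‖) := by
    refine ⟨2 * max M 0, ?_⟩
    rintro _ ⟨b, rfl⟩
    refine Real.iSup_le (fun hb => (norm_repSp_sub_le π π' b).trans ?_) (by positivity)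
    exact mul_le_mul_of_nonneg_left ((hM b hb).trans (le_max_left _ _)) zero_le_two
  exact (ciSup_pos (f := fun _ : a ∈ K => ‖π a - π' a‖) ha).ge.trans (le_ciSup hbd a)

/-- Evaluation at an element of the *-algebra generated by `K` is Lipschitz for `dRep K`. -/
theorem exists_norm_sub_le_mul_dRep {K : Set A} (hK : IsCompact K) {a : A}
    (ha : a ∈ StarAlgebra.adjoin ℂ K) :
    ∃ C, 0 ≤ C ∧ ∀ π π' : RepSp A, ‖π a - π' a‖ ≤ C * dRep K π π' := by
  induction ha using StarAlgebra.adjoin_induction with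
  | mem x hx => exact ⟨1, zero_le_one, fun π π' => by simpa using norm_sub_le_dRep hK π π' hx⟩
  | algebraMap r =>
    refine ⟨0, le_rfl, fun π π' => ?_⟩
    rw [AlgHomClass.commutes, AlgHomClass.commutes]
    simp
  | add x y _ _ hx hy =>
    obtain ⟨C, hC, hx⟩ := hx
    obtain ⟨D, hD, hy⟩ := hy
    refine ⟨C + D, add_nonneg hC hD, fun π π' => ?_⟩
    rw [map_add, map_add, add_sub_add_comm, add_mul]
    exact (norm_add_le _ _).trans (add_le_add (hx π π') (hy π π'))
  | mul x y _ _ hx hy =>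
    obtain ⟨C, hC, hx⟩ := hx
    obtain ⟨D, hD, hy⟩ := hy
    refine ⟨‖x‖ * D + C * ‖y‖, by positivity, fun π π' => ?_⟩
    have hd := dRep_nonneg K π π'
    have key : π (x * y) - π' (x * y) = π x * (π y - π' y) + (π x - π' x) * π' y := by
      rw [map_mul, map_mul, mul_sub, sub_mul, sub_add_sub_cancel]
    calc ‖π (x * y) - π' (x * y)‖
        ≤ ‖π x‖ * ‖π y - π' y‖ + ‖π x - π' x‖ * ‖π' y‖ := by
          rw [key]
          exact (norm_add_le _ _).trans (add_le_add (norm_mul_le _ _) (norm_mul_le _ _))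
      _ ≤ ‖x‖ * (D * dRep K π π') + C * dRep K π π' * ‖y‖ := by
          gcongr
          · exact NonUnitalStarAlgHom.norm_apply_le π x
          · exact hy π π'
          · exact hx π π'
          · exact NonUnitalStarAlgHom.norm_apply_le π' y
      _ = (‖x‖ * D + C * ‖y‖) * dRep K π π' := by ring
  | star x _ hx =>
    obtain ⟨C, hC, hx⟩ := hx
    refine ⟨C, hC, fun π π' => ?_⟩
    rw [map_star, map_star, ← star_sub, norm_star]
    exact hx π π'

theorem exists_dRep_le_add_mul_dRep {K K' : Set A} (hK : IsCompact K) (hgen : Generates K)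
    (hK' : IsCompact K') {ε : ℝ} (hε : 0 < ε) :
    ∃ C, 0 ≤ C ∧ ∀ π π' : RepSp A, dRep K' π π' ≤ ε + C * dRep K π π' := by
  suffices H : ∃ C, 0 ≤ C ∧ ∀ a ∈ K', ∀ π π' : RepSp A, ‖π a - π' a‖ ≤ ε + C * dRep K π π' by
    obtain ⟨C, hC, h⟩ := H
    refine ⟨C, hC, fun π π' => dRep_le ?_ fun a ha => h a ha π π'⟩
    have := dRep_nonneg K π π'
    positivity
  refine hK'.induction_on ?_ ?_ ?_ ?_
  · exact ⟨0, le_rfl, by simp⟩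
  · rintro s t hst ⟨C, hC, h⟩
    exact ⟨C, hC, fun a ha => h a (hst ha)⟩
  · rintro s t ⟨C, hC, hs⟩ ⟨D, hD, ht⟩
    refine ⟨max C D, hC.trans (le_max_left _ _), ?_⟩
    rintro a (ha | ha) π π'
    · refine (hs a ha π π').trans ?_
      have := dRep_nonneg K π π'
      gcongr
      exact le_max_left _ _
    · refine (ht a ha π π').trans ?_
      have := dRep_nonneg K π π'
      gcongr
      exact le_max_right _ _
  · intro x hx
    have hx' : x ∈ closure (StarAlgebra.adjoin ℂ K : Set A) := by
      rw [← StarSubalgebra.topologicalClosure_coe, hgen]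
      trivial
    obtain ⟨b, hb, hxb⟩ := Metric.mem_closure_iff.1 hx' (ε / 2) (half_pos hε)
    obtain ⟨C, hC, h⟩ := exists_norm_sub_le_mul_dRep hK hb
    refine ⟨Metric.ball b (ε / 2), mem_nhdsWithin_of_mem_nhds (Metric.isOpen_ball.mem_nhds hxb),
      C, hC, fun a ha π π' => ?_⟩
    have hab : ‖a - b‖ < ε / 2 := by rwa [← dist_eq_norm]
    have key : π a - π' a = (π (a - b) - π' (a - b)) + (π b - π' b) := by
      rw [map_sub, map_sub]
      abel
    rw [key]
    linarith [norm_add_le (π (a - b) - π' (a - b)) (π b - π' b), norm_repSp_sub_le π π' (a - b),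
      h π π']

end Representations

theorem stmt6 (A : Type*) [CStarAlgebra A] [TopologicalSpace.SeparableSpace A]
    (K K' : Set A) (hK : IsCompact K) (hgenK : Generates K)
    (hK' : IsCompact K') (hgenK' : Generates K') :
    ∃ ω : ℝ → ℝ, IsModulus ω ∧
      ∀ π π' : RepSp A, dRep K' π π' ≤ ω (dRep K π π') := by
  obtain ⟨ω, hω, h⟩ := exists_isModulus_of_forall_le_add_mul
    (fun p : RepSp A × RepSp A => dRep K p.1 p.2) (fun p => dRep K' p.1 p.2)
    fun ε hε => by
      obtain ⟨C, hC, h⟩ := exists_dRep_le_add_mul_dRep hK hgenK hK' hε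
      exact ⟨C, hC, fun p => h p.1 p.2⟩
  exact ⟨ω, hω, fun π π' => h (π, π')⟩
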